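/- (Soundness of differential induction for equations / conservation laws.) Fix n : ℕ, polynomials θ i ∈ ℝ[x₁,…,xₙ] for i : Fin n, a polynomial p ∈ ℝ[x₁,…,xₙ], and a set χ ⊆ (Fin n → ℝ). Assume that for every x ∈ χ, (∑ i, (pderiv i p) * θ i).eval x = 0. Let r ≥ 0 and let φ : ℝ → (Fin n → ℝ) solve the system on [0, r] with φ t ∈ χ for all t ∈ [0, r]. Then p.eval (φ t) = p.eval (φ 0) for all t ∈ [0, r]. -/

import Mathlib

open MvPolynomial

/-- Chain rule for a multivariate polynomial evaluated along a differentiable curve. -/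
theorem MvPolynomial.hasDerivAt_eval_comp {𝕜 σ : Type*} [NontriviallyNormedField 𝕜] [Fintype σ]
    (p : MvPolynomial σ 𝕜) {φ : 𝕜 → σ → 𝕜} {v : σ → 𝕜} {t : 𝕜}
    (hφ : ∀ i, HasDerivAt (fun s => φ s i) (v i) t) :
    HasDerivAt (fun s => p.eval (φ s)) (∑ i, (pderiv i p).eval (φ t) * v i) t := by
  classical
  induction p using MvPolynomial.induction_on with
  | C a => simpa using hasDerivAt_const t a
  | add p q hp hq =>
    simpa [add_mul, Finset.sum_add_distrib] using hp.fun_add hq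
  | mul_X p j hp =>
    simp only [eval_mul, eval_X]
    refine (hp.fun_mul (hφ j)).congr_deriv ?_
    simp only [pderiv_mul, pderiv_X, map_add, map_mul, eval_X, add_mul, Finset.sum_add_distrib,
      Finset.sum_mul]
    congr 1
    · exact Finset.sum_congr rfl fun i _ => by ring
    · simp [Pi.single_apply, apply_ite]

/-- Soundness of differential induction for equational invariants
(conservation laws): if the Lie derivative of p vanishes on the evolution
domain, then p is constant along solutions. -/
theorem differential_induction_eq (n : ℕ) (θ : Fin n → MvPolynomial (Fin n) ℝ)
    (p : MvPolynomial (Fin n) ℝ) (χ : Set (Fin n → ℝ))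
    (hLie : ∀ x ∈ χ, (∑ i, pderiv i p * θ i).eval x = 0)
    (r : ℝ) (hr : r ≥ 0) (φ : ℝ → (Fin n → ℝ))
    (hφ : ∀ i : Fin n, ∀ t ∈ Set.Icc (0 : ℝ) r,
      HasDerivAt (fun s => φ s i) ((θ i).eval (φ t)) t)
    (hχ : ∀ t ∈ Set.Icc (0 : ℝ) r, φ t ∈ χ) :
    ∀ t ∈ Set.Icc (0 : ℝ) r, p.eval (φ t) = p.eval (φ 0) := by
  have hderiv : ∀ t ∈ Set.Icc (0 : ℝ) r, HasDerivAt (fun s => p.eval (φ s)) 0 t := fun t ht =>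
    (p.hasDerivAt_eval_comp fun i => hφ i t ht).congr_deriv <| by
      simpa only [map_sum, map_mul] using hLie (φ t) (hχ t ht)
  exact constant_of_has_deriv_right_zero
    (fun t ht => (hderiv t ht).continuousAt.continuousWithinAt)
    fun t ht => (hderiv t (Set.Ico_subset_Icc_self ht)).hasDerivWithinAt
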